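/- Let D = 2. A bilinear map α : m × m → m is rotation equivariant and lorentzian-boost equivariant if and only if there exists t ∈ ℝ such that α = t·α₀, where α₀ is the bilinear map determined by α₀(H,H) = 0, α₀(H,P_a) = −Σ_b ε_{ab} P_b, α₀(P_a,H) = Σ_b ε_{ab} P_b and α₀(P_a,P_b) = ε_{ab} H, with ε the 2×2 matrix ε_{12} = 1, ε_{21} = −1, ε_{11} = ε_{22} = 0. In particular the space of invariant Nomizu maps for the three-dimensional lorentzian homogeneous spacetimes is exactly one-dimensional. -/

import Mathlib

open Matrix

/-- The vector space `m = ℝ × ℝ^D`, with elements written `(h, p)`;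
`H = (1, 0)` and `P a = (0, e a)`. -/
abbrev Mspace (D : ℕ) : Type := ℝ × (Fin D → ℝ)

/-- The infinitesimal rotation `ρ_Λ (h, p) = (0, Λ p)` associated to a `D × D` matrix `Λ`. -/
noncomputable def rotMap {D : ℕ} (Λ : Matrix (Fin D) (Fin D) ℝ) :
    Mspace D →ₗ[ℝ] Mspace D :=
  LinearMap.prod 0 (Λ.mulVecLin ∘ₗ LinearMap.snd ℝ ℝ (Fin D → ℝ))

/-- The lorentzian boost `β_a (h, p) = (p_a, h • e_a)`. -/
noncomputable def lorBoost {D : ℕ} (a : Fin D) : Mspace D →ₗ[ℝ] Mspace D :=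
  LinearMap.prod
    (LinearMap.proj a ∘ₗ LinearMap.snd ℝ ℝ (Fin D → ℝ))
    (LinearMap.toSpanSingleton ℝ (Fin D → ℝ) (Pi.single a 1) ∘ₗ
      LinearMap.fst ℝ ℝ (Fin D → ℝ))

/-- A bilinear map `α : m × m → m` is equivariant under a linear endomorphism `X` of `m`
if `X (α Y Z) = α (X Y) Z + α Y (X Z)` for all `Y Z ∈ m`. -/
def IsEquivariant {D : ℕ} (X : Mspace D →ₗ[ℝ] Mspace D)
    (α : Mspace D →ₗ[ℝ] Mspace D →ₗ[ℝ] Mspace D) : Prop :=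
  ∀ Y Z : Mspace D, X (α Y Z) = α (X Y) Z + α Y (X Z)

/-- The `2 × 2` antisymmetric matrix `ε` with `ε₁₂ = 1`, `ε₂₁ = -1`. -/
noncomputable def eps : Matrix (Fin 2) (Fin 2) ℝ := !![0, 1; -1, 0]

theorem rotMap_apply {D : ℕ} (Λ : Matrix (Fin D) (Fin D) ℝ) (v : Mspace D) :
    rotMap Λ v = (0, Λ *ᵥ v.2) := rfl

theorem lorBoost_apply {D : ℕ} (a : Fin D) (v : Mspace D) :
    lorBoost a v = (v.2 a, v.1 • Pi.single a 1) := rfl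

theorem Mspace.exists_eq (v : Mspace 2) : ∃ h a b, v = (h, ![a, b]) :=
  ⟨v.1, v.2 0, v.2 1, by ext i <;> [rfl; (fin_cases i <;> rfl)]⟩

theorem Mspace.eq_sum_basis (v : Mspace 2) :
    v = v.1 • ((1, 0) : Mspace 2) + v.2 0 • ((0, ![1, 0]) : Mspace 2) +
      v.2 1 • ((0, ![0, 1]) : Mspace 2) := by
  ext i
  · simp
  · fin_cases i <;> simp

/-- Expansion of a bilinear map over the basis `H`, `P 0`, `P 1`. -/
theorem Mspace.bilin_expand (α : Mspace 2 →ₗ[ℝ] Mspace 2 →ₗ[ℝ] Mspace 2) (h k a b c d : ℝ) :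
    α (h, ![a, b]) (k, ![c, d]) =
      h • k • α (1, 0) (1, 0) + h • c • α (1, 0) (0, ![1, 0]) + h • d • α (1, 0) (0, ![0, 1]) +
      a • k • α (0, ![1, 0]) (1, 0) + a • c • α (0, ![1, 0]) (0, ![1, 0]) +
        a • d • α (0, ![1, 0]) (0, ![0, 1]) +
      b • k • α (0, ![0, 1]) (1, 0) + b • c • α (0, ![0, 1]) (0, ![1, 0]) +
        b • d • α (0, ![0, 1]) (0, ![0, 1]) := by
  conv_lhs => rw [Mspace.eq_sum_basis (h, ![a, b]), Mspace.eq_sum_basis (k, ![c, d])]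
  simp only [map_add, map_smul, LinearMap.add_apply, LinearMap.smul_apply, smul_add, cons_val_zero,
    cons_val_one, cons_val_fin_one]
  module

/-- For `D = 2`, a bilinear map `α` on `m = ℝ × ℝ²` is rotation equivariant and
lorentzian-boost equivariant if and only if it is a real multiple of the bilinear map `α₀`
with `α₀(H,H) = 0`, `α₀(H,P_a) = -ε_{ab} P_b`, `α₀(P_a,H) = ε_{ab} P_b` and
`α₀(P_a,P_b) = ε_{ab} H`: the space of invariant Nomizu maps of the three-dimensional
lorentzian homogeneous spacetimes is exactly one-dimensional. -/
theorem lorentzian_nomizu_map_dim_two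
    (α : Mspace 2 →ₗ[ℝ] Mspace 2 →ₗ[ℝ] Mspace 2) :
    ((∀ Λ : Matrix (Fin 2) (Fin 2) ℝ, Λᵀ = -Λ → IsEquivariant (rotMap Λ) α) ∧
      (∀ a : Fin 2, IsEquivariant (lorBoost a) α))
    ↔ ∃ t : ℝ, ∀ v w : Mspace 2,
        α v w = t • ((v.2 ⬝ᵥ eps.mulVec w.2,
          v.1 • eps.mulVec w.2 - w.1 • eps.mulVec v.2) : Mspace 2) := by
  constructor
  · rintro ⟨hR, hB⟩
    have hR' := hR eps (by ext i j; fin_cases i <;> fin_cases j <;> simp [eps])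
    have rot (h k a b c d : ℝ) := hR' (h, ![a, b]) (k, ![c, d])
    have bst (h k a b c d : ℝ) := hB 0 (h, ![a, b]) (k, ![c, d])
    have e₀ : (Pi.single 0 1 : Fin 2 → ℝ) = ![1, 0] := by
      ext i; fin_cases i <;> simp
    have hε (a b : ℝ) : eps *ᵥ ![a, b] = ![b, -a] := by
      ext i; fin_cases i <;> simp [eps]
    refine ⟨(α (0, ![1, 0]) (0, ![0, 1])).1, fun v w => ?_⟩
    obtain ⟨h, a, b, rfl⟩ := Mspace.exists_eq v
    obtain ⟨k, c, d, rfl⟩ := Mspace.exists_eq w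
    have expand := Mspace.bilin_expand α
    generalize α (1, 0) (1, 0) = A₁, α (1, 0) (0, ![1, 0]) = A₂, α (1, 0) (0, ![0, 1]) = A₃,
      α (0, ![1, 0]) (1, 0) = A₄, α (0, ![1, 0]) (0, ![1, 0]) = A₅,
      α (0, ![1, 0]) (0, ![0, 1]) = A₆, α (0, ![0, 1]) (1, 0) = A₇,
      α (0, ![0, 1]) (0, ![1, 0]) = A₈, α (0, ![0, 1]) (0, ![0, 1]) = A₉ at expand ⊢
    simp only [rotMap_apply, lorBoost_apply, e₀, hε, smul_cons, smul_empty, smul_eq_mul,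
      mul_one, mul_zero, cons_val_zero, expand] at rot bst ⊢
    obtain ⟨x₁, y₁, z₁, rfl⟩ := Mspace.exists_eq A₁
    obtain ⟨x₂, y₂, z₂, rfl⟩ := Mspace.exists_eq A₂
    obtain ⟨x₃, y₃, z₃, rfl⟩ := Mspace.exists_eq A₃
    obtain ⟨x₄, y₄, z₄, rfl⟩ := Mspace.exists_eq A₄
    obtain ⟨x₅, y₅, z₅, rfl⟩ := Mspace.exists_eq A₅
    obtain ⟨x₆, y₆, z₆, rfl⟩ := Mspace.exists_eq A₆
    obtain ⟨x₇, y₇, z₇, rfl⟩ := Mspace.exists_eq A₇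
    obtain ⟨x₈, y₈, z₈, rfl⟩ := Mspace.exists_eq A₈
    obtain ⟨x₉, y₉, z₉, rfl⟩ := Mspace.exists_eq A₉
    simp only [hε, Prod.ext_iff, Prod.smul_mk, Prod.mk_add_mk,
      smul_cons, smul_empty, smul_eq_mul, cons_add_cons, empty_add_empty, vecCons_inj, and_true,
      cons_val_zero] at rot bst ⊢
    have r₀₀ := rot 1 1 0 0 0 0
    have r₀₁ := rot 1 0 0 0 1 0
    have r₀₂ := rot 1 0 0 0 0 1
    have r₁₀ := rot 0 1 1 0 0 0
    have r₁₁ := rot 0 0 1 0 1 0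
    have r₁₂ := rot 0 0 1 0 0 1
    have r₂₀ := rot 0 1 0 1 0 0
    have r₂₁ := rot 0 0 0 1 1 0
    have r₂₂ := rot 0 0 0 1 0 1
    have b₀₀ := bst 1 1 0 0 0 0
    have b₀₁ := bst 1 0 0 0 1 0
    have b₀₂ := bst 1 0 0 0 0 1
    have b₁₀ := bst 0 1 1 0 0 0
    have b₁₁ := bst 0 0 1 0 1 0
    have b₁₂ := bst 0 0 1 0 0 1
    have b₂₀ := bst 0 1 0 1 0 0
    have b₂₁ := bst 0 0 0 1 1 0
    have b₂₂ := bst 0 0 0 1 0 1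
    simp only [one_mul, zero_mul, mul_zero, add_zero, zero_add, neg_zero, neg_mul]
      at r₀₀ r₀₁ r₀₂ r₁₀ r₁₁ r₁₂ r₂₀ r₂₁ r₂₂ b₀₀ b₀₁ b₀₂ b₁₀ b₁₁ b₁₂ b₂₀ b₂₁ b₂₂
    clear rot bst expand
    have sol :
        x₁ = 0 ∧ y₁ = 0 ∧ z₁ = 0 ∧
        x₂ = 0 ∧ y₂ = 0 ∧ z₂ = -x₆ ∧
        x₃ = 0 ∧ y₃ = x₆ ∧ z₃ = 0 ∧
        x₄ = 0 ∧ y₄ = 0 ∧ z₄ = x₆ ∧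
        x₅ = 0 ∧ y₅ = 0 ∧ z₅ = 0 ∧
        y₆ = 0 ∧ z₆ = 0 ∧
        x₇ = 0 ∧ y₇ = -x₆ ∧ z₇ = 0 ∧
        x₈ = -x₆ ∧ y₈ = 0 ∧ z₈ = 0 ∧
        x₉ = 0 ∧ y₉ = 0 ∧ z₉ = 0 := by
      grind
    obtain ⟨rfl, rfl, rfl, rfl, rfl, rfl, rfl, rfl, rfl, rfl, rfl, rfl, rfl, rfl, rfl,
      rfl, rfl, rfl, rfl, rfl, rfl, rfl, rfl, rfl, rfl, rfl⟩ := sol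
    refine ⟨?_, ?_⟩
    · simp; ring
    · ext i; fin_cases i <;> simp <;> ring
  · rintro ⟨t, ht⟩
    refine ⟨fun Λ hΛ v w => ?_, fun a v w => ?_⟩
    · have h00 := congrFun₂ hΛ 0 0
      have h01 := congrFun₂ hΛ 0 1
      have h11 := congrFun₂ hΛ 1 1
      simp only [transpose_apply, Matrix.neg_apply] at h00 h01 h11
      have h0 : Λ 0 0 = 0 := by linarith
      have h1 : Λ 1 1 = 0 := by linarith
      ext i
      · simp [ht, rotMap_apply, eps, mulVec, dotProduct, Fin.sum_univ_two, h0, h1, h01]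
        ring
      · fin_cases i <;>
          simp [ht, rotMap_apply, eps, mulVec, dotProduct, Fin.sum_univ_two, h0, h1, h01] <;>
          ring
    · ext i
      · fin_cases a <;>
          simp [ht, lorBoost_apply, eps, mulVec, dotProduct, Fin.sum_univ_two] <;> ring
      · fin_cases a <;> fin_cases i <;>
          simp [ht, lorBoost_apply, eps, mulVec, dotProduct, Fin.sum_univ_two] <;> ring
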